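/- Define the four-loop twist-1 ABJM anomalous dimension as the function of N ∈ ℕ given by γ₄(N) = −16·(S_{−3} − S₃ + S_{−2,−1} − S_{−2,1} + S_{−1,−2} − S_{−1,2} − S_{1,−2} + S_{1,2} − S_{2,−1} + S_{2,1} + S_{−1,−1,−1} − S_{−1,−1,1} − S_{1,−1,−1} + S_{1,−1,1})(N), where each nested harmonic sum is evaluated at N. Then γ₄(2n+1) = γ₄(2n+2) for every natural number n. -/

import Mathlib

/-- Nested (signed) harmonic sum `S_{a₁,…,a_ℓ}(N)`,
`S_{a₁,…,a_ℓ}(N) = Σ_{n=1}^{N} (sign a₁)^n / n^{|a₁|} · S_{a₂,…,a_ℓ}(n)`, with `S_{}(n) = 1`. -/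
noncomputable def nestedS : List ℤ → ℕ → ℝ
  | [], _ => 1
  | a :: b, N => ∑ n ∈ Finset.Icc 1 N, ((Int.sign a : ℝ)) ^ n / (n : ℝ) ^ a.natAbs * nestedS b n

/-- Four-loop twist-1 ABJM (asymptotic) anomalous dimension `γ₄^{ABA}(N)`. -/
noncomputable def gammaFourTwistOne (N : ℕ) : ℝ :=
  (-16 : ℝ) * (nestedS [-3] N - nestedS [3] N + nestedS [-2, -1] N - nestedS [-2, 1] N + nestedS [-1, -2] N - nestedS [-1, 2] N - nestedS [1, -2] N + nestedS [1, 2] N - nestedS [2, -1] N + nestedS [2, 1] N + nestedS [-1, -1, -1] N - nestedS [-1, -1, 1] N - nestedS [1, -1, -1] N + nestedS [1, -1, 1] N)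

/-- The summands of `S_{a,b}` and `S_{-a,b}` at an even argument coincide, so the difference
`S_{-a,b} - S_{a,b}` is unchanged by a step to an even argument. -/
theorem nestedS_neg_cons_sub_nestedS_cons_of_even (a : ℤ) (b : List ℤ) {m : ℕ}
    (hm : Even (m + 1)) :
    nestedS (-a :: b) m - nestedS (a :: b) m =
      nestedS (-a :: b) (m + 1) - nestedS (a :: b) (m + 1) := by
  simp only [nestedS, Finset.sum_Icc_succ_top (Nat.le_add_left 1 m), Int.sign_neg,
    Int.natAbs_neg, Int.cast_neg, hm.neg_pow]
  ring

/-- Shift symmetry of the four-loop twist-1 ABJM anomalous dimension: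
`γ₄^{ABA}(2n+1) = γ₄^{ABA}(2n+2)`. -/
theorem twist1_four_loop_shift_symmetry (n : ℕ) :
    gammaFourTwistOne (2 * n + 1) = gammaFourTwistOne (2 * n + 2) := by
  have hm : Even (2 * n + 1 + 1) := ⟨n + 1, by ring⟩
  have h (a : ℤ) (b : List ℤ) := nestedS_neg_cons_sub_nestedS_cons_of_even a b hm
  unfold gammaFourTwistOne
  linear_combination (-16 : ℝ) * (h 3 [] + h 2 [-1] - h 2 [1] + h 1 [-2] - h 1 [2] +
    h 1 [-1, -1] - h 1 [-1, 1])
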